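/- Let n ≥ 1 and let k, k' ≥ 1. Let a ∈ ⋀ᵏ(ℝⁿ) and b ∈ ⋀^{k'}(ℝⁿ) be elements with a ∧ b ≠ 0. Suppose v₁,…,v_m ∈ ⋀¹(ℝⁿ) satisfy a ∧ v_i = 0 for each i ∈ {1,…,m}, and suppose w₁,…,w_m ∈ ⋀^{k-1}(ℝⁿ) satisfy v_i ∧ w_ℓ = δ_{iℓ}·a for all i, ℓ ∈ {1,…,m}, where δ_{iℓ} is the Kronecker delta. Then m < n. -/

import Mathlib

namespace ExteriorAlgebra

variable {R M : Type*} [CommRing R] [AddCommGroup M] [Module R M]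

/-- An element annihilating every vector from the left annihilates every exterior power of
positive degree. -/
theorem mul_eq_zero_of_forall_mul_ι_eq_zero {a b : ExteriorAlgebra R M} {k : ℕ} (hk : 1 ≤ k)
    (ha : ∀ x : M, a * ι R x = 0) (hb : b ∈ ⋀[R]^k M) : a * b = 0 := by
  obtain ⟨j, rfl⟩ := Nat.exists_eq_add_of_le' hk
  rw [exteriorPower, pow_succ'] at hb
  induction hb using Submodule.mul_induction_on' with
  | mem_mul_mem x hx y hy =>
    obtain ⟨x, rfl⟩ := hx
    rw [← mul_assoc, ha, zero_mul]
  | add x hx y hy ihx ihy => rw [mul_add, ihx, ihy, add_zero]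

/-- Vectors with a dual family, up to a nonzero factor `a`, are linearly independent. -/
theorem linearIndependent_of_ι_mul_eq_ite {K V I : Type*} [Field K] [AddCommGroup V] [Module K V]
    [Fintype I] [DecidableEq I] {a : ExteriorAlgebra K V} (ha : a ≠ 0) {u : I → V}
    {w : I → ExteriorAlgebra K V} (h : ∀ i l, ι K (u i) * w l = if i = l then a else 0) :
    LinearIndependent K u := by
  rw [Fintype.linearIndependent_iff]
  intro c hc l
  have hl : ι K (∑ i, c i • u i) * w l = c l • a := by
    simp [Finset.sum_mul, h]
  rw [hc, map_zero, zero_mul] at hl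
  exact (smul_eq_zero.mp hl.symm).resolve_right ha

end ExteriorAlgebra

/-- Exterior-algebra content of Lemma 7.2: if `a ∈ ⋀ᵏ(ℝⁿ)`, `b ∈ ⋀^{k'}(ℝⁿ)` with
`a ∧ b ≠ 0`, `v₁,…,v_m ∈ ⋀¹(ℝⁿ)` satisfy `a ∧ v_i = 0`, and `w₁,…,w_m ∈ ⋀^{k-1}(ℝⁿ)`
satisfy `v_i ∧ w_ℓ = δ_{iℓ} a`, then `m < n`. -/
theorem lemma_7_2_exterior (n k k' m : ℕ) (hn : 1 ≤ n) (hk : 1 ≤ k) (hk' : 1 ≤ k')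
    (a b : ExteriorAlgebra ℝ (Fin n → ℝ))
    (ha : a ∈ ⋀[ℝ]^k (Fin n → ℝ)) (hb : b ∈ ⋀[ℝ]^k' (Fin n → ℝ))
    (hab : a * b ≠ 0)
    (v w : Fin m → ExteriorAlgebra ℝ (Fin n → ℝ))
    (hv : ∀ i, v i ∈ ⋀[ℝ]^1 (Fin n → ℝ))
    (hw : ∀ i, w i ∈ ⋀[ℝ]^(k - 1) (Fin n → ℝ))
    (hav : ∀ i, a * v i = 0)
    (hvw : ∀ i ℓ, v i * w ℓ = if i = ℓ then a else 0) :
    m < n := by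
  have hu : ∀ i, ∃ x, ExteriorAlgebra.ι ℝ x = v i := fun i => by
    simpa [ExteriorAlgebra.exteriorPower] using hv i
  choose u hu using hu
  have hli : LinearIndependent ℝ u :=
    ExteriorAlgebra.linearIndependent_of_ι_mul_eq_ite (left_ne_zero_of_mul hab)
      (fun i l => by rw [hu, hvw])
  have hmn : m ≤ n := by simpa using hli.fintype_card_le_finrank
  refine lt_of_le_of_ne hmn fun hm => hab ?_
  have hspan : Submodule.span ℝ (Set.range u) = ⊤ :=
    hli.span_eq_top_of_card_eq_finrank' (by simpa using hm)
  have hker : Submodule.span ℝ (Set.range u) ≤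
      LinearMap.ker (LinearMap.mulLeft ℝ a ∘ₗ ExteriorAlgebra.ι ℝ) := by
    rw [Submodule.span_le]
    rintro _ ⟨i, rfl⟩
    simp [hu, hav]
  refine ExteriorAlgebra.mul_eq_zero_of_forall_mul_ι_eq_zero hk' (fun x => ?_) hb
  exact hker (hspan ▸ Submodule.mem_top)
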